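/- arXiv:2208.14429 — 2 statements merged into one kernel-verified Lean document; each statement's English description precedes it below -/
import Mathlib

section
/- Let f : R → S be a cyclically pure map of commutative rings, where R and S are integral domains and S is integrally closed in its fraction field. Then R is integrally closed in its fraction field. -/
/-- A ring map `f : R → S` is *cyclically pure* if `f⁻¹(I·S) = I` for every ideal `I ⊆ R`.
If `f : R → S` is a cyclically pure map of integral domains and `S` is integrally closed in
its fraction field, then `R` is integrally closed in its fraction field. -/
theorem cyclicallyPure_isIntegrallyClosed {R S : Type*} [CommRing R] [CommRing S]
    [IsDomain R] [IsDomain S] [IsIntegrallyClosed S]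
    (f : R →+* S) (hf : ∀ I : Ideal R, (I.map f).comap f = I) :
    IsIntegrallyClosed R := by
  have hinj : Function.Injective f := by
    refine (injective_iff_map_eq_zero f).2 fun a ha => ?_
    have hmem : a ∈ ((⊥ : Ideal R).map f).comap f := by simp [ha]
    rwa [hf, Ideal.mem_bot] at hmem
  let g : FractionRing R →+* FractionRing S := IsFractionRing.map hinj
  have hg (r : R) : g (algebraMap R _ r) = algebraMap S _ (f r) := IsLocalization.map_eq _ r
  rw [isIntegrallyClosed_iff (FractionRing R)]
  intro x hx
  obtain ⟨s, hs⟩ := IsIntegrallyClosed.algebraMap_eq_of_integral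
    (hx.map_of_comp_eq f g (RingHom.ext fun r => (hg r).symm))
  obtain ⟨a, b, hb, rfl⟩ := IsFractionRing.div_surjective (A := R) x
  have hb0 : algebraMap R (FractionRing R) b ≠ 0 :=
    IsFractionRing.to_map_ne_zero_of_mem_nonZeroDivisors hb
  have hfab : f a = f b * s := by
    apply IsFractionRing.injective S (FractionRing S)
    rw [map_mul, hs, ← hg, ← hg, ← map_mul, mul_div_cancel₀ _ hb0]
  have hab : a ∈ Ideal.span {b} := by
    rw [← hf (Ideal.span {b}), Ideal.mem_comap, hfab]
    exact Ideal.mul_mem_right _ _ (Ideal.mem_map_of_mem f (Ideal.mem_span_singleton_self b))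
  obtain ⟨r, rfl⟩ := Ideal.mem_span_singleton.1 hab
  exact ⟨r, by rw [map_mul, mul_div_cancel_left₀ _ hb0]⟩
end

section
/- Let f : R → S be a cyclically pure map of commutative rings, where R and S are essentially of finite type over the field ℂ of complex numbers and S is reduced. Then f is pure: for every R-module N the induced map N → N ⊗_R S is injective. -/
open Polynomial in
/-- `J` is an ideal of the `K`-algebra `T` such that `T ⧸ J` is integral over `K`. -/
def Ideal.IsIntegralQuotient (K : Type*) {T : Type*} [CommRing K] [CommRing T] [Algebra K T]
    (J : Ideal T) : Prop :=
  ∀ t : T, ∃ g : K[X], g.Monic ∧ aeval t g ∈ J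

/-- Every ideal of `T` with integral quotient contains the largest ideal inside the kernel of some
`K`-linear functional on `T` that vanishes on an ideal with integral quotient. -/
def HasSmallFunctionals (K T : Type*) [CommRing K] [CommRing T] [Algebra K T] : Prop :=
  ∀ J : Ideal T, J.IsIntegralQuotient K → ∃ (ℓ : T →ₗ[K] K) (J' : Ideal T),
    J'.IsIntegralQuotient K ∧ (∀ x ∈ J', ℓ x = 0) ∧ ∀ r, (∀ s, ℓ (r * s) = 0) → r ∈ J

/-- Every nonzero element of a finite `R`-module has nonzero image in some cyclic `R`-module. -/
def CyclicModulesSeparate.{u, w} (R : Type u) [CommRing R] : Prop :=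
  ∀ (N : Type w) [AddCommGroup N] [Module R N] [Module.Finite R N] (n : N), n ≠ 0 →
    ∃ (I : Ideal R) (φ : N →ₗ[R] R ⧸ I), φ n ≠ 0

namespace Ideal.IsIntegralQuotient

variable {K T T' : Type*} [CommRing K] [CommRing T] [CommRing T'] [Algebra K T] [Algebra K T']
  {J : Ideal T}

theorem mono {J' : Ideal T} (h : J.IsIntegralQuotient K) (hJ : J ≤ J') :
    J'.IsIntegralQuotient K := fun t ↦
  let ⟨g, hg, hgJ⟩ := h t
  ⟨g, hg, hJ hgJ⟩

theorem pow (h : J.IsIntegralQuotient K) (n : ℕ) : (J ^ n).IsIntegralQuotient K := fun t ↦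
  let ⟨g, hg, hgJ⟩ := h t
  ⟨g ^ n, hg.pow n, by simpa using Ideal.pow_mem_pow hgJ n⟩

theorem map (h : J.IsIntegralQuotient K) {f : T →ₐ[K] T'} (hf : Function.Surjective f) :
    (J.map f).IsIntegralQuotient K := fun t ↦ by
  obtain ⟨t, rfl⟩ := hf t
  obtain ⟨g, hg, hgJ⟩ := h t
  exact ⟨g, hg, by simpa [Polynomial.aeval_algHom_apply] using Ideal.mem_map_of_mem f hgJ⟩

theorem comap {J : Ideal T'} (h : J.IsIntegralQuotient K) (f : T →ₐ[K] T') :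
    (J.comap f).IsIntegralQuotient K := fun t ↦ by
  obtain ⟨g, hg, hgJ⟩ := h (f t)
  exact ⟨g, hg, by simpa [Polynomial.aeval_algHom_apply] using hgJ⟩

theorem iInf {ι : Type*} [Finite ι] {J : ι → Ideal T} (h : ∀ i, (J i).IsIntegralQuotient K) :
    (⨅ i, J i).IsIntegralQuotient K := fun t ↦ by
  have := Fintype.ofFinite ι
  choose g hg hgJ using fun i ↦ h i t
  refine ⟨∏ i, g i, Polynomial.monic_prod_of_monic _ _ fun i _ ↦ hg i, ?_⟩
  rw [Ideal.mem_iInf]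
  intro i
  rw [map_prod]
  exact (J i).mem_of_dvd (Finset.dvd_prod_of_mem _ (Finset.mem_univ i)) (hgJ i)

theorem finite_quotient [Algebra.FiniteType K T] (h : J.IsIntegralQuotient K) :
    Module.Finite K (T ⧸ J) := by
  have : Algebra.IsIntegral K (T ⧸ J) := ⟨fun x ↦ by
    obtain ⟨t, rfl⟩ := Ideal.Quotient.mk_surjective x
    obtain ⟨g, hg, hgJ⟩ := h t
    refine ⟨g, hg, ?_⟩
    have := Polynomial.aeval_algHom_apply (Ideal.Quotient.mkₐ K J) t g
    rw [Polynomial.aeval_def] at this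
    exact this.trans (Ideal.Quotient.eq_zero_iff_mem.mpr hgJ)⟩
  exact Algebra.IsIntegral.finite

end Ideal.IsIntegralQuotient

/-- A consequence of the Artin–Rees lemma. -/
theorem Ideal.exists_pow_mul_mem_imp_mem {T : Type*} [CommRing T] [IsNoetherianRing T]
    (J : Ideal T) {c : T} (hc : c ∈ nonZeroDivisors T) :
    ∃ N : ℕ, ∀ r, c * r ∈ J ^ N → r ∈ J := by
  obtain ⟨k, hk⟩ := J.exists_pow_inf_eq_pow_smul (Ideal.span {c})
  refine ⟨k + 1, fun r hr ↦ ?_⟩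
  have h1 : c * r ∈ J ^ (k + 1) • (⊤ : Ideal T) ⊓ Ideal.span {c} :=
    ⟨by simpa using hr, Ideal.mul_mem_right _ _ (Ideal.mem_span_singleton_self c)⟩
  rw [hk (k + 1) (by omega)] at h1
  have h2 : c * r ∈ J * Ideal.span {c} := by
    simpa using! Submodule.smul_mono (show J ^ (k + 1 - k) ≤ J by simp) inf_le_right h1
  obtain ⟨j, hj, h⟩ := Ideal.mem_mul_span_singleton.mp h2
  have : r = j := by
    rw [mul_comm] at h
    exact ((mul_cancel_left_mem_nonZeroDivisors hc).mp h).symm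
  exact this ▸ hj

/-- A nondegenerate functional identifies a finite dimensional algebra with its dual, so modules
killed by a small enough ideal map to cyclic modules. -/
theorem HasSmallFunctionals.exists_linearMap_quotient {K T : Type*} [Field K] [CommRing T]
    [Algebra K T] [Algebra.FiniteType K T] (H : HasSmallFunctionals K T) {J : Ideal T}
    (hJ : J.IsIntegralQuotient K) {N : Type*} [AddCommGroup N] [Module K N] [Module T N]
    [IsScalarTower K T N] (hN : ∀ x ∈ J, ∀ n : N, x • n = 0) {n : N} (hn : n ≠ 0) :
    ∃ (I : Ideal T) (φ : N →ₗ[T] T ⧸ I), φ n ≠ 0 := by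
  obtain ⟨ℓ, J', hJ', hℓ, hr⟩ := H J hJ
  let I : Ideal T :=
    { carrier := {r | ∀ s, ℓ (r * s) = 0}
      add_mem' := fun ha hb s ↦ by rw [add_mul, map_add, ha s, hb s, add_zero]
      zero_mem' := fun s ↦ by simp
      smul_mem' := fun c x hx s ↦ by
        have := hx (c * s)
        rwa [show c • x * s = x * (c * s) by simp only [smul_eq_mul]; ring] }
  have hIJ : I ≤ J := hr
  have hI : J' ≤ I := fun x hx s ↦ hℓ _ (Ideal.mul_mem_right s _ hx)
  have : Module.Finite K (T ⧸ I) := (hJ'.mono hI).finite_quotient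
  let ℓI : (T ⧸ I) →ₗ[K] K := (I.restrictScalars K).liftQ ℓ fun x hx ↦ by
    simpa using hx 1
  have ℓI_mk (t : T) : ℓI (Ideal.Quotient.mk I t) = ℓ t := rfl
  let B : (T ⧸ I) →ₗ[K] Module.Dual K (T ⧸ I) := (LinearMap.mul K (T ⧸ I)).compr₂ ℓI
  have hB : Function.Injective B := by
    rw [injective_iff_map_eq_zero]
    intro x hx
    obtain ⟨r, rfl⟩ := Ideal.Quotient.mk_surjective x
    refine Ideal.Quotient.eq_zero_iff_mem.mpr fun s ↦ ?_
    exact DFunLike.congr_fun hx (Ideal.Quotient.mk I s)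
  let e : (T ⧸ I) ≃ₗ[K] Module.Dual K (T ⧸ I) :=
    LinearEquiv.ofInjectiveOfFinrankEq B hB Subspace.dual_finrank_eq.symm
  have he (x y : T ⧸ I) : e x y = ℓI (x * y) := rfl
  obtain ⟨ψ, hψ⟩ := Module.Projective.exists_dual_ne_zero K hn
  let F (ν : N) : Module.Dual K (T ⧸ I) :=
    (I.restrictScalars K).liftQ (ψ ∘ₗ (LinearMap.toSpanSingleton T N ν).restrictScalars K)
      fun x hx ↦ by simp [hN x (hIJ hx)]
  have hF (ν : N) (t : T) : F ν (Ideal.Quotient.mk I t) = ψ (t • ν) := rfl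
  refine ⟨I,
    { toFun := fun ν ↦ e.symm (F ν)
      map_add' := fun a b ↦ ?_
      map_smul' := fun t a ↦ ?_ }, fun h ↦ hψ ?_⟩
  · rw [← map_add]
    congr 1
    refine LinearMap.ext fun x ↦ ?_
    obtain ⟨s, rfl⟩ := Ideal.Quotient.mk_surjective x
    rw [LinearMap.add_apply, hF, hF, hF, smul_add, map_add]
  · rw [LinearEquiv.symm_apply_eq]
    refine LinearMap.ext fun x ↦ ?_
    obtain ⟨s, rfl⟩ := Ideal.Quotient.mk_surjective x
    rw [he, RingHom.id_apply, Algebra.smul_def, mul_right_comm, mul_comm, ← he,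
      LinearEquiv.apply_symm_apply, hF, Ideal.Quotient.algebraMap_eq, ← map_mul, hF, mul_comm,
      mul_smul]
  · have h0 : F n = 0 := by simpa using h
    have := hF n 1
    rw [h0] at this
    simpa using this.symm

/-- The property passes from the irreducible components to a reduced algebra. -/
theorem HasSmallFunctionals.of_isReduced {K T : Type*} [CommRing K] [CommRing T] [Algebra K T]
    [IsNoetherianRing T] [IsReduced T]
    (H : ∀ q ∈ minimalPrimes T, HasSmallFunctionals K (T ⧸ q)) : HasSmallFunctionals K T := by
  classical
  intro J hJ
  have hfin : Finite (minimalPrimes T) := minimalPrimes.finite_of_isNoetherianRing T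
  have := Fintype.ofFinite (minimalPrimes T)
  have hprime (q : minimalPrimes T) : q.1.IsPrime := q.2.1.1
  have hzero (x : T) (hx : ∀ q : minimalPrimes T, x ∈ q.1) : x = 0 := by
    have : x ∈ sInf (⊥ : Ideal T).minimalPrimes := Ideal.mem_sInf.mpr fun {q} hq ↦ hx ⟨q, hq⟩
    rw [Ideal.sInf_minimalPrimes] at this
    rwa [show (⊥ : Ideal T).radical = 0 from nilradical_eq_zero T] at this
  have hsep (q : minimalPrimes T) : ∃ c ∉ q.1, ∀ q' ≠ q, c ∈ q'.1 := by
    have (q' : minimalPrimes T) : ∃ c ∉ q.1, q' ≠ q → c ∈ q'.1 := by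
      by_cases h : q' = q
      · exact ⟨1, (Ideal.ne_top_iff_one _).mp (hprime q).ne_top, fun h' ↦ absurd h h'⟩
      · obtain ⟨c, hc, hc'⟩ := Set.not_subset.mp fun hle : q'.1 ≤ q.1 ↦
          h (Subtype.ext (le_antisymm hle (q.2.2 q'.2.1 hle)))
        exact ⟨c, hc', fun _ ↦ hc⟩
    choose c hc hc' using this
    refine ⟨∏ q', c q', ?_, fun q' hq' ↦
      Ideal.mem_of_dvd _ (Finset.dvd_prod_of_mem c (Finset.mem_univ q')) (hc' q' hq')⟩
    rw [Ideal.IsPrime.prod_mem_iff]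
    rintro ⟨q', -, h⟩
    exact hc q' h
  choose c hc hc' using hsep
  have hcmul (q : minimalPrimes T) (x : T) (hx : x ∈ q.1) : c q * x = 0 := hzero _ fun q' ↦ by
    by_cases h : q' = q
    · exact Ideal.mul_mem_left _ _ (h ▸ hx)
    · exact Ideal.mul_mem_right _ _ (hc' q q' h)
  have hsum (q : minimalPrimes T) : ∑ q', c q' ^ 2 ∉ q.1 := by
    rw [← Finset.add_sum_erase _ _ (Finset.mem_univ q), Ideal.add_mem_iff_left]
    · exact fun h ↦ hc q ((hprime q).mem_of_pow_mem 2 h)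
    · exact Ideal.sum_mem _ fun q' hq' ↦ Ideal.pow_mem_of_mem _
        (hc' q' q (Finset.ne_of_mem_erase hq').symm) 2 (by simp)
  have hreg : ∑ q, c q ^ 2 ∈ nonZeroDivisors T := by
    rw [mem_nonZeroDivisors_iff_right]
    intro x hx
    exact hzero x fun q ↦ ((hprime q).mem_or_mem (hx ▸ q.1.zero_mem)).resolve_right (hsum q)
  obtain ⟨N, hN⟩ := J.exists_pow_mul_mem_imp_mem hreg
  choose ℓ J' hJ' hℓ hr using fun q : minimalPrimes T ↦
    H q.1 q.2 _ ((hJ.pow N).map (Ideal.Quotient.mkₐ_surjective K q.1))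
  refine ⟨∑ q, ℓ q ∘ₗ (Ideal.Quotient.mkₐ K q.1).toLinearMap,
    ⨅ q, (J' q).comap (Ideal.Quotient.mkₐ K q.1), .iInf fun q ↦ (hJ' q).comap _,
    fun x hx ↦ ?_, fun r hrad ↦ hN r ?_⟩
  · simp only [LinearMap.sum_apply]
    exact Finset.sum_eq_zero fun q _ ↦ hℓ q _ (Ideal.mem_iInf.mp hx q)
  · rw [Finset.sum_mul]
    refine Ideal.sum_mem _ fun q _ ↦ ?_
    have h1 : Ideal.Quotient.mkₐ K q.1 (r * c q) ∈ (J ^ N).map (Ideal.Quotient.mkₐ K q.1) := by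
      refine hr q _ fun s ↦ ?_
      obtain ⟨s, rfl⟩ := Ideal.Quotient.mkₐ_surjective K q.1 s
      have := hrad (c q * s)
      rw [LinearMap.sum_apply, Finset.sum_eq_single q] at this
      · simpa [mul_assoc] using this
      · intro q' _ hq'
        have : Ideal.Quotient.mk q'.1 (c q) = 0 := Ideal.Quotient.eq_zero_iff_mem.mpr (hc' q q' hq')
        simp [this]
      · simp
    obtain ⟨y, hy, hyr⟩ :=
      (Ideal.mem_map_iff_of_surjective _ (Ideal.Quotient.mkₐ_surjective K q.1)).mp h1
    have h2 : y - r * c q ∈ q.1 := Ideal.Quotient.eq.mp hyr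
    have h3 : c q ^ 2 * r = c q * y := by linear_combination -hcmul q _ h2
    exact h3 ▸ Ideal.mul_mem_left _ _ hy

open nonZeroDivisors in
/-- A domain `T` finite over a domain `A` has an `A`-linear functional whose associated bilinear
form is nondegenerate up to a fixed denominator, uniformly modulo all ideals of `A`. -/
theorem exists_functional_mul_mem_map (A T : Type*) [CommRing A] [IsDomain A] [IsNoetherianRing A]
    [CommRing T] [IsDomain T] [Algebra A T] [FaithfulSMul A T] [Module.Finite A T] :
    ∃ (φ : T →ₗ[A] A) (c : T), c ≠ 0 ∧
      ∀ (a : Ideal A) (r : T), (∀ s, φ (r * s) ∈ a) → c * r ∈ a.map (algebraMap A T) := by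
  let F := FractionRing A
  let V := Localization (Algebra.algebraMapSubmonoid T A⁰)
  have hle : Algebra.algebraMapSubmonoid T A⁰ ≤ T⁰ := by
    rintro _ ⟨a, ha, rfl⟩
    exact mem_nonZeroDivisors_of_ne_zero
      ((map_ne_zero_iff _ (FaithfulSMul.algebraMap_injective A T)).mpr (nonZeroDivisors.ne_zero ha))
  have : IsDomain V := IsLocalization.isDomain_localization hle
  have hV : IsField V := isField_of_isIntegral_of_isField' (R := F) (Field.toIsField F)
  let f : T →ₗ[A] V := (IsScalarTower.toAlgHom A T V).toLinearMap
  have hf : Function.Injective f := IsLocalization.injective V hle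
  have hfmul (x y : T) : f (x * y) = f x * f y := map_mul (algebraMap T V) x y
  obtain ⟨g, hg⟩ := Module.Projective.exists_dual_ne_zero F (one_ne_zero (α := V))
  let B : V →ₗ[F] Module.Dual F V := (LinearMap.mul F V).compr₂ g
  have hB : Function.Injective B := by
    rw [injective_iff_map_eq_zero]
    intro x hx
    by_contra h
    obtain ⟨y, hy⟩ := hV.mul_inv_cancel h
    have : g (x * y) = 0 := DFunLike.congr_fun hx y
    exact hg (hy ▸ this)
  let e : V ≃ₗ[F] Module.Dual F V :=
    LinearEquiv.ofInjectiveOfFinrankEq B hB Subspace.dual_finrank_eq.symm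
  have he (x y : V) : g (x * y) = e x y := rfl
  let b := Module.finBasis F V
  have hb (x : V) : x = ∑ j, g (e.symm (b.coord j) * x) • b j := by
    simp only [he, LinearEquiv.apply_symm_apply, Module.Basis.coord_apply, b.sum_repr]
  have := Module.finitePresentation_of_finite A T
  obtain ⟨φ, s, hφ⟩ := Module.FinitePresentation.exists_lift_of_isLocalizedModule A⁰
    (Algebra.linearMap A F) (g.restrictScalars A ∘ₗ f)
  obtain ⟨a₁, h₁⟩ := IsLocalizedModule.exist_integer_multiples_of_finite A⁰ f
    fun j ↦ e.symm (b.coord j)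
  obtain ⟨a₂, h₂⟩ := IsLocalizedModule.exist_integer_multiples_of_finite A⁰ f b
  choose t ht using h₁
  choose u hu using h₂
  have hφ' (x : T) : algebraMap A F (φ x) = algebraMap A F s * g (f x) := by
    have := DFunLike.congr_fun hφ x
    simpa [Submonoid.smul_def, Algebra.smul_def] using this
  have key (r : T) : ((s * a₁ * a₂ : A⁰) : A) • r = ∑ j, φ (r * t j) • u j := by
    apply hf
    simp only [map_sum, map_smul, hu]
    conv_lhs => rw [hb (f r)]
    rw [Finset.smul_sum]
    refine Finset.sum_congr rfl fun j _ ↦ ?_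
    rw [← algebraMap_smul F (φ _), hφ', hfmul, ht, mul_comm (f r), smul_mul_assoc,
      LinearMap.map_smul_of_tower, ← algebraMap_smul F (_ : A) (_ : V),
      ← algebraMap_smul F (a₂ : A) (b j), Algebra.smul_def (a₁ : A) (_ : F), smul_smul, smul_smul]
    congr 1
    simp only [Submonoid.coe_mul, map_mul]
    ring
  refine ⟨φ, algebraMap A T (s * a₁ * a₂ : A⁰), nonZeroDivisors.ne_zero
    (hle ⟨_, (s * a₁ * a₂).2, rfl⟩), fun a r hr ↦ ?_⟩
  rw [← Algebra.smul_def, key]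
  refine Ideal.sum_mem _ fun j _ ↦ ?_
  rw [Algebra.smul_def]
  exact Ideal.mul_mem_right _ _ (Ideal.mem_map_of_mem _ (hr _))

/-- Noether normalization with the variables sent into a prescribed ideal. -/
theorem exists_finite_inj_algHom_mem {K T : Type*} [Field K] [CommRing T] [Nontrivial T]
    [Algebra K T] [Algebra.FiniteType K T] {J : Ideal T} (hJ : J.IsIntegralQuotient K) :
    ∃ (d : ℕ) (g : MvPolynomial (Fin d) K →ₐ[K] T),
      Function.Injective g ∧ g.Finite ∧ ∀ i, g (.X i) ∈ J := by
  obtain ⟨d, g, hg, hfin⟩ := exists_finite_inj_algHom_of_fg K T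
  choose p hp hpJ using fun i ↦ hJ (g (.X i))
  have hq (i) : (Polynomial.X * p i).Monic := Polynomial.monic_X.mul (hp i)
  let q (i) : MvPolynomial (Fin d) K := Polynomial.aeval (.X i) (Polynomial.X * p i)
  have hqind : AlgebraicIndependent K q :=
    MvPolynomial.algebraicIndependent_polynomial_aeval_X _ fun i ↦ by
      refine Polynomial.transcendental _ ?_ (by simp [(hq i).leadingCoeff])
      rw [Polynomial.monic_X.natDegree_mul (hp i)]
      simp
  refine ⟨d, g.comp (MvPolynomial.aeval q), hg.comp hqind, ?_, fun i ↦ ?_⟩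
  · refine AlgHom.Finite.comp hfin ?_
    have hint : (MvPolynomial.aeval (R := K) q).toRingHom.IsIntegral := fun x ↦ by
      induction x using MvPolynomial.induction_on with
      | C a =>
        have := (MvPolynomial.aeval (R := K) q).toRingHom.isIntegralElem_map (x := MvPolynomial.C a)
        simpa [MvPolynomial.algebraMap_eq] using this
      | add x y hx hy => exact hx.add _ hy
      | mul_X x i hx =>
        refine hx.mul _ ⟨(Polynomial.X * p i).map MvPolynomial.C - Polynomial.C (.X i), ?_, ?_⟩
        · refine ((hq i).map _).sub_of_left ((Polynomial.degree_C_le).trans_lt ?_)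
          rw [(hq i).degree_map, Polynomial.degree_eq_natDegree (hq i).ne_zero,
            Polynomial.monic_X.natDegree_mul (hp i), Polynomial.natDegree_X]
          exact_mod_cast Nat.lt_of_lt_of_le one_pos (Nat.le_add_right 1 _)
        · have : (MvPolynomial.aeval (R := K) q).toRingHom.comp MvPolynomial.C =
              algebraMap K (MvPolynomial (Fin d) K) := (MvPolynomial.aeval q).comp_algebraMap
          rw [Polynomial.eval₂_sub, Polynomial.eval₂_map, this, Polynomial.eval₂_C]
          simp [q, Polynomial.aeval_def]
    have hft : ((MvPolynomial.aeval (R := K) q).toRingHom.comp (algebraMap K _)).FiniteType := by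
      rw [show (MvPolynomial.aeval (R := K) q).toRingHom.comp (algebraMap K _) = algebraMap K _ from
        (MvPolynomial.aeval q).comp_algebraMap]
      exact RingHom.finiteType_algebraMap.mpr inferInstance
    exact hint.to_finite hft.of_comp_finiteType
  · have : (g.comp (MvPolynomial.aeval q)) (.X i) =
        g (.X i) * Polynomial.aeval (g (.X i)) (p i) := by
      simp [q, ← Polynomial.aeval_algHom_apply]
    exact this ▸ Ideal.mul_mem_left _ _ (hpJ i)

/-- If `T` is integral over a polynomial ring over `K`, killing the variables leaves an integral
`K`-algebra. -/
theorem Ideal.isIntegralQuotient_map_idealOfVars {K T σ : Type*} [CommRing K] [CommRing T]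
    [Algebra K T] [Algebra (MvPolynomial σ K) T] [IsScalarTower K (MvPolynomial σ K) T]
    [Algebra.IsIntegral (MvPolynomial σ K) T] :
    ((MvPolynomial.idealOfVars σ K).map (algebraMap _ T)).IsIntegralQuotient K := fun t ↦ by
  obtain ⟨P, hP, hPt⟩ := Algebra.IsIntegral.isIntegral (R := MvPolynomial σ K) t
  refine ⟨P.map MvPolynomial.constantCoeff, hP.map _, ?_⟩
  set I := (MvPolynomial.idealOfVars σ K).map (algebraMap _ T)
  have hcomp : ((Ideal.Quotient.mk I).comp (algebraMap K T)).comp MvPolynomial.constantCoeff =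
      (Ideal.Quotient.mk I).comp (algebraMap (MvPolynomial σ K) T) := by
    refine MvPolynomial.ringHom_ext (fun a ↦ ?_) fun i ↦ ?_
    · rw [RingHom.comp_apply, MvPolynomial.constantCoeff_C, RingHom.comp_apply, RingHom.comp_apply,
        IsScalarTower.algebraMap_apply K (MvPolynomial σ K) T, MvPolynomial.algebraMap_eq]
    · simp only [RingHom.comp_apply, MvPolynomial.constantCoeff_X, map_zero]
      exact (Ideal.Quotient.eq_zero_iff_mem.mpr (Ideal.mem_map_of_mem _
        (Ideal.subset_span (Set.mem_range_self i)))).symm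
  rw [← Ideal.Quotient.eq_zero_iff_mem, Polynomial.aeval_def, Polynomial.hom_eval₂,
    Polynomial.eval₂_map, hcomp, ← Polynomial.hom_eval₂, hPt, map_zero]

/-- The functional is the coefficient of a large monomial in a nondegenerate functional over a Noether
normalization. -/
theorem HasSmallFunctionals.of_isDomain (K T : Type*) [Field K] [CommRing T] [IsDomain T]
    [Algebra K T] [Algebra.FiniteType K T] : HasSmallFunctionals K T := by
  intro J hJ
  obtain ⟨d, g, hinj, hfin, hgJ⟩ := exists_finite_inj_algHom_mem hJ
  let A := MvPolynomial (Fin d) K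
  let _ : Algebra A T := g.toRingHom.toAlgebra
  have : IsScalarTower K A T := .of_algebraMap_eq' g.comp_algebraMap.symm
  have : Module.Finite A T := hfin
  have : FaithfulSMul A T := (faithfulSMul_iff_algebraMap_injective A T).mpr hinj
  have : IsNoetherianRing T := Algebra.FiniteType.isNoetherianRing K T
  let X : Ideal A := MvPolynomial.idealOfVars (Fin d) K
  have hXJ : X.map (algebraMap A T) ≤ J := by
    rw [Ideal.map_le_iff_le_comap]
    exact Ideal.span_le.mpr (Set.range_subset_iff.mpr hgJ)
  obtain ⟨φ, c, hc, hφ⟩ := exists_functional_mul_mem_map A T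
  obtain ⟨N, hN⟩ := J.exists_pow_mul_mem_imp_mem (mem_nonZeroDivisors_of_ne_zero hc)
  let ξ : Fin d →₀ ℕ := Finsupp.equivFunOnFinite.symm fun _ ↦ N
  refine ⟨MvPolynomial.lcoeff K ξ ∘ₗ φ.restrictScalars K,
    (X.map (algebraMap A T)) ^ (ξ.degree + 1),
    Ideal.isIntegralQuotient_map_idealOfVars.pow _, fun x hx ↦ ?_, fun r hr ↦ hN r ?_⟩
  · rw [← Ideal.map_pow] at hx
    have hx' : x ∈ X ^ (ξ.degree + 1) • (⊤ : Submodule A T) := by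
      rwa [Ideal.smul_top_eq_map]
    have hφx : φ x ∈ X ^ (ξ.degree + 1) • (⊤ : Submodule A A) :=
      Submodule.smul_mono le_rfl le_top
        ((Submodule.map_smul'' (X ^ (ξ.degree + 1)) ⊤ φ).le (Submodule.mem_map_of_mem hx'))
    rw [smul_eq_mul, Ideal.mul_top] at hφx
    exact (MvPolynomial.mem_pow_idealOfVars_iff' _ _).mp hφx ξ (Nat.lt_succ_self _)
  · refine Ideal.pow_right_mono hXJ N ?_
    rw [← Ideal.map_pow]
    refine hφ _ r fun s ↦ (MvPolynomial.mem_pow_idealOfVars_iff' _ _).mpr fun β hβ ↦ ?_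
    have hle : β ≤ ξ := fun i ↦ (Finsupp.le_degree i β).trans hβ.le
    have h : MvPolynomial.coeff ξ (φ (r * (MvPolynomial.monomial (ξ - β) (1 : K) : A) • s)) = 0 :=
      hr ((MvPolynomial.monomial (ξ - β) (1 : K) : A) • s)
    rwa [mul_smul_comm, map_smul, smul_eq_mul, ← tsub_add_cancel_of_le hle,
      add_tsub_cancel_right, MvPolynomial.coeff_monomial_mul, one_mul] at h

theorem hasSmallFunctionals (K T : Type*) [Field K] [CommRing T] [IsReduced T]
    [Algebra K T] [Algebra.FiniteType K T] : HasSmallFunctionals K T := by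
  have : IsNoetherianRing T := Algebra.FiniteType.isNoetherianRing K T
  refine .of_isReduced fun q hq ↦ ?_
  have : q.IsPrime := hq.1.1
  exact .of_isDomain K (T ⧸ q)

open IsLocalRing in
/-- Local rings of a reduced finite type algebra at maximal ideals have separating cyclic modules. -/
theorem CyclicModulesSeparate.of_isLocalization_of_isLocalRing {K T L : Type*} [Field K]
    [CommRing T] [CommRing L] [Algebra K T] [Algebra.FiniteType K T] [IsReduced T] [Algebra T L]
    (W : Submonoid T) [IsLocalization W L] [IsLocalRing L]
    (hp : ((maximalIdeal L).comap (algebraMap T L)).IsIntegralQuotient K) :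
    CyclicModulesSeparate L := by
  intro N _ _ _ n hn
  have : IsNoetherianRing T := Algebra.FiniteType.isNoetherianRing K T
  have : IsNoetherianRing L := IsLocalization.isNoetherianRing W L inferInstance
  set p := (maximalIdeal L).comap (algebraMap T L) with hpdef
  have hmax : p.IsMaximal := by
    have := hp.finite_quotient
    exact Ideal.Quotient.maximal_of_isField _
      (isField_of_isIntegral_of_isField' (R := K) (Field.toIsField K))
  obtain ⟨k, hk⟩ : ∃ k : ℕ, n ∉ maximalIdeal L ^ k • (⊤ : Submodule L N) := by
    by_contra! h
    have h' := (Submodule.mem_iInf _).mpr h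
    rw [Ideal.iInf_pow_smul_eq_bot_of_isLocalRing _ (maximalIdeal.isMaximal L).ne_top] at h'
    exact hn h'
  let N' := N ⧸ maximalIdeal L ^ k • (⊤ : Submodule L N)
  let π : N →ₗ[L] N' := Submodule.mkQ _
  have hπn : π n ≠ 0 := fun h ↦ hk ((Submodule.Quotient.mk_eq_zero _).mp h)
  let _ : Module T N' := Module.compHom N' (algebraMap T L)
  let _ : Module K N' := Module.compHom N' (algebraMap K T)
  have : IsScalarTower T L N' := .of_algebraMap_smul fun _ _ ↦ rfl
  have : IsScalarTower K T N' := .of_algebraMap_smul fun _ _ ↦ rfl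
  have hkill : ∀ x ∈ p ^ k, ∀ m : N', x • m = 0 := by
    intro x hx m
    obtain ⟨m, rfl⟩ := Submodule.mkQ_surjective _ m
    have hx' : algebraMap T L x ∈ maximalIdeal L ^ k :=
      Ideal.le_comap_pow (algebraMap T L) k hx
    rw [← algebraMap_smul L x, ← map_smul]
    exact (Submodule.Quotient.mk_eq_zero _).mpr (Submodule.smul_mem_smul hx' trivial)
  obtain ⟨I, φ, hφ⟩ := (hasSmallFunctionals K T).exists_linearMap_quotient (hp.pow k) hkill hπn
  let ι : (T ⧸ I) →ₗ[T] L ⧸ I.map (algebraMap T L) :=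
    Submodule.liftQ I (Algebra.linearMap T _) fun x hx ↦ by
      exact Ideal.Quotient.eq_zero_iff_mem.mpr (Ideal.mem_map_of_mem _ hx)
  have hι (x : T) : ι (Ideal.Quotient.mk I x) = Ideal.Quotient.mk _ (algebraMap T L x) := rfl
  refine ⟨I.map (algebraMap T L), (ι ∘ₗ φ).extendScalarsOfIsLocalization W L ∘ₗ π, fun h ↦ hφ ?_⟩
  replace h : ι (φ (π n)) = 0 := h
  obtain ⟨x, hx⟩ := Ideal.Quotient.mk_surjective (φ (π n))
  rw [← hx, hι, Ideal.Quotient.eq_zero_iff_mem, IsLocalization.mem_map_algebraMap_iff W] at h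
  obtain ⟨⟨i, w⟩, hiw⟩ := h
  rw [← map_mul, IsLocalization.eq_iff_exists W] at hiw
  obtain ⟨w', hw'⟩ := hiw
  let v : W := w' * w
  have hv : v.1 * x ∈ I := by
    rw [show v.1 * x = w' * (x * w) by simp only [v, Submonoid.coe_mul]; ring, hw']
    exact I.mul_mem_left _ i.2
  have hvp : v.1 ∉ p := fun h ↦
    (mem_maximalIdeal _).mp h (IsLocalization.map_units L v)
  obtain ⟨u, a, ha, hua⟩ : ∃ u, ∃ a ∈ p ^ k, u * v.1 + a = 1 := by
    have h1 : IsCoprime (Ideal.span {v.1}) (p ^ k) := by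
      refine IsCoprime.pow_right ?_
      obtain ⟨y, a, ha, h⟩ := hmax.exists_inv hvp
      exact Ideal.isCoprime_iff_exists.mpr
        ⟨_, Ideal.mem_span_singleton'.mpr ⟨y, rfl⟩, a, ha, h⟩
    obtain ⟨b, hb, a, ha, hab⟩ := Ideal.isCoprime_iff_exists.mp h1
    obtain ⟨u, rfl⟩ := Ideal.mem_span_singleton'.mp hb
    exact ⟨u, a, ha, hab⟩
  have h1 : v.1 • φ (π n) = 0 := by
    rw [← hx, Algebra.smul_def]
    exact Ideal.Quotient.eq_zero_iff_mem.mpr hv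
  rw [← one_smul T (φ (π n)), ← hua, add_smul, mul_smul, h1, ← map_smul, hkill a ha]
  simp

open IsLocalRing nonZeroDivisors in
/-- A lift of a transcendence basis of the residue field makes the local ring essentially of finite
type over a field over which its residue field is algebraic. -/
theorem CyclicModulesSeparate.of_essFiniteType_of_isLocalRing (k : Type*) {L : Type*} [Field k]
    [CommRing L] [IsLocalRing L] [IsReduced L] [Algebra k L] [Algebra.EssFiniteType k L] :
    CyclicModulesSeparate L := by
  obtain ⟨ι, x, hx⟩ := exists_isTranscendenceBasis' k (ResidueField L)
  choose y hy using fun i ↦ residue_surjective (x i)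
  let A := MvPolynomial ι k
  let K := FractionRing A
  have hres (a : A) : residue L (MvPolynomial.aeval y a) = MvPolynomial.aeval x a := by
    rw [show x = fun i ↦ residue L (y i) from funext fun i ↦ (hy i).symm]
    exact (MvPolynomial.aeval_algebraMap_apply (B := ResidueField L) y a).symm
  have hunit (a : A⁰) : IsUnit ((MvPolynomial.aeval y : A →ₐ[k] L) a) := by
    rw [← residue_ne_zero_iff_isUnit, hres]
    exact (map_ne_zero_iff _ hx.1).mpr (nonZeroDivisors.ne_zero a.2)
  let F : K →ₐ[k] L := IsLocalization.liftAlgHom (M := A⁰) (f := MvPolynomial.aeval y) hunit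
  have hF (a : A) : F (algebraMap A K a) = MvPolynomial.aeval y a :=
    IsLocalization.lift_eq hunit a
  let _ : Algebra K L := F.toRingHom.toAlgebra
  have : IsScalarTower k K L := .of_algebraMap_eq' F.comp_algebraMap.symm
  have : Algebra.EssFiniteType K L := .of_comp k K L
  have : IsReduced (Algebra.EssFiniteType.subalgebra K L) :=
    isReduced_of_injective (Algebra.EssFiniteType.subalgebra K L).val Subtype.val_injective
  refine .of_isLocalization_of_isLocalRing (K := K) (T := Algebra.EssFiniteType.subalgebra K L)
    (Algebra.EssFiniteType.submonoid K L) fun t ↦ ?_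
  obtain ⟨P, hP, hPt⟩ := hx.isAlgebraic.isAlgebraic (residue L t)
  let Q : Polynomial K := (P.map hx.1.aevalEquiv.symm.toRingHom).map (algebraMap A K)
  have hQ : Q ≠ 0 := by
    rwa [Ne, Polynomial.map_eq_zero_iff (IsFractionRing.injective A K),
      Polynomial.map_eq_zero_iff hx.1.aevalEquiv.symm.injective]
  refine ⟨Q * Polynomial.C Q.leadingCoeff⁻¹, Polynomial.monic_mul_leadingCoeff_inv hQ, ?_⟩
  rw [map_mul]
  refine Ideal.mul_mem_right _ _ ?_
  have hcomp : (((residue L).comp (algebraMap K L)).comp (algebraMap A K)).comp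
      hx.1.aevalEquiv.symm.toRingHom =
        algebraMap (Algebra.adjoin k (Set.range x)) (ResidueField L) := by
    refine RingHom.ext fun z ↦ ?_
    obtain ⟨a, rfl⟩ := hx.1.aevalEquiv.surjective z
    change residue L (F (algebraMap A K (hx.1.aevalEquiv.symm (hx.1.aevalEquiv a)))) = _
    rw [AlgEquiv.symm_apply_apply, hF, hres]
    exact (hx.1.algebraMap_aevalEquiv a).symm
  rw [Ideal.mem_comap, ← residue_eq_zero_iff, ← Polynomial.aeval_algebraMap_apply,
    Polynomial.aeval_def, Polynomial.hom_eval₂]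
  simp only [Q, Polynomial.eval₂_map]
  rw [hcomp]
  exact hPt

universe u w

/-- Separation by cyclic modules can be checked at the maximal ideals. -/
theorem CyclicModulesSeparate.of_localization_maximal {R : Type u} [CommRing R]
    [IsNoetherianRing R]
    (H : ∀ (m : Ideal R) [m.IsMaximal],
      CyclicModulesSeparate.{u, max u w} (Localization.AtPrime m)) :
    CyclicModulesSeparate.{u, w} R := by
  intro N _ _ _ n hn
  obtain ⟨m, hm, hle⟩ := Ideal.exists_le_maximal (Module.annihilator R (Submodule.span R {n}))
    (by rwa [Ne, Module.annihilator_eq_top_iff, Submodule.subsingleton_iff_eq_bot,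
      Submodule.span_singleton_eq_bot])
  let f := LocalizedModule.mkLinearMap m.primeCompl N
  have hf : f n ≠ 0 := fun h ↦ by
    obtain ⟨c, hc⟩ := (IsLocalizedModule.eq_zero_iff m.primeCompl f).mp h
    exact c.2 (hle ((Submodule.mem_annihilator_span_singleton n _).mpr hc))
  obtain ⟨I, φ, hφ⟩ := H m _ (f n) hf
  obtain ⟨I', rfl⟩ := (Submodule.localized'gi (Localization.AtPrime m) m.primeCompl
    (Algebra.linearMap R (Localization.AtPrime m))).l_surjective I
  let g := I'.toLocalizedQuotient' (Localization.AtPrime m) m.primeCompl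
    (Algebra.linearMap R (Localization.AtPrime m))
  have := Module.finitePresentation_of_finite R N
  obtain ⟨h, s, hs⟩ := Module.FinitePresentation.exists_lift_of_isLocalizedModule m.primeCompl g
    (φ.restrictScalars R ∘ₗ f)
  refine ⟨I', h, fun h0 ↦ hφ ?_⟩
  have hn : s • φ (f n) = 0 := by simpa [h0] using (DFunLike.congr_fun hs n).symm
  exact IsLocalizedModule.smul_injective g s (hn.trans (smul_zero s).symm)

open TensorProduct in
/-- If cyclic modules separate, cyclic purity implies purity. -/
theorem CyclicModulesSeparate.injective_tmul_one {R : Type u} {S : Type*} [CommRing R]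
    [CommRing S] [Algebra R S] (H : CyclicModulesSeparate.{u, w} R)
    (hf : ∀ I : Ideal R, (I.map (algebraMap R S)).comap (algebraMap R S) = I)
    (N : Type w) [AddCommGroup N] [Module R N] :
    Function.Injective fun n : N ↦ n ⊗ₜ[R] (1 : S) := by
  refine (injective_iff_map_eq_zero ((TensorProduct.mk R N S).flip 1)).mpr fun n hn ↦ ?_
  by_contra hn0
  obtain ⟨Q, hPQ, hQ, h⟩ := TensorProduct.eq_zero_of_fg_of_subtype_eq_zero
    (Submodule.fg_span_singleton n)
    (t := (⟨n, Submodule.mem_span_singleton_self n⟩ : Submodule.span R {n}) ⊗ₜ[R] (1 : S))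
    (by simpa using hn)
  rw [LinearMap.rTensor_tmul] at h
  have : Module.Finite R Q := .of_fg hQ
  obtain ⟨I, φ, hφ⟩ := H Q ⟨n, hPQ (Submodule.mem_span_singleton_self n)⟩
    fun h ↦ hn0 (congrArg Subtype.val h)
  obtain ⟨r, hr⟩ := Ideal.Quotient.mk_surjective (φ ⟨n, hPQ (Submodule.mem_span_singleton_self n)⟩)
  let J := I.map (algebraMap R S)
  let ψ : (R ⧸ I) ⊗[R] S →ₗ[R] S ⧸ J := TensorProduct.lift
    ((LinearMap.mul R (S ⧸ J)).compl₁₂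
      (Ideal.quotientMapₐ J (Algebra.ofId R S) Ideal.le_comap_map).toLinearMap
      (Ideal.Quotient.mkₐ R J).toLinearMap)
  have hψ : ψ (φ.rTensor S _) = 0 := congrArg (ψ ∘ φ.rTensor S) h |>.trans (by simp)
  refine hφ ?_
  rw [← hr, Ideal.Quotient.eq_zero_iff_mem, ← hf I, Ideal.mem_comap,
    ← Ideal.Quotient.eq_zero_iff_mem]
  rw [LinearMap.rTensor_tmul] at hψ
  change ψ (φ ⟨n, _⟩ ⊗ₜ 1) = 0 at hψ
  rw [← hr] at hψ
  simp only [ψ, TensorProduct.lift.tmul, LinearMap.compl₁₂_apply, AlgHom.toLinearMap_apply,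
    LinearMap.mul_apply', map_one, mul_one] at hψ
  exact hψ

/-- Let `f : R → S` be a cyclically pure map (`f⁻¹(I·S) = I` for all ideals `I ⊆ R`) of rings
essentially of finite type over `ℂ`, with `S` reduced. Then `f` is pure: for every `R`-module
`N` the induced map `N → N ⊗_R S`, `n ↦ n ⊗ 1`, is injective. -/
theorem cyclicallyPure_pure_of_essFiniteType {R S : Type*} [CommRing R] [CommRing S]
    [Algebra ℂ R] [Algebra ℂ S] [Algebra.EssFiniteType ℂ R] [Algebra.EssFiniteType ℂ S]
    (f : R →+* S) (hf : ∀ I : Ideal R, (I.map f).comap f = I) (hS : IsReduced S) :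
    letI : Algebra R S := f.toAlgebra
    ∀ (N : Type*) [AddCommGroup N] [Module R N],
      Function.Injective (fun n : N => n ⊗ₜ[R] (1 : S)) := by
  intro N _ _
  have : IsReduced R := isReduced_of_injective f <| by
    rw [RingHom.injective_iff_ker_eq_bot, RingHom.ker, ← hf ⊥, Ideal.map_bot]
  have : IsNoetherianRing R := Algebra.EssFiniteType.isNoetherianRing ℂ R
  have H (m : Ideal R) [m.IsMaximal] : CyclicModulesSeparate (Localization.AtPrime m) :=
    .of_essFiniteType_of_isLocalRing ℂ
  let _ : Algebra R S := f.toAlgebra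
  exact (CyclicModulesSeparate.of_localization_maximal H).injective_tmul_one hf N
end
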